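/- With coordinates (a₁,a₂,a₃,a₄,α₁,α₂,α₃,β₁,β₂,γ) on ℝ¹⁰, consider the linear subspace Σ₁ = {β₁ = β₂ = γ = 0}. Then: (i) at every point of Σ₁, the values of the six vector fields V₁, V₂, V₃, T₁, T₂, T₃ are tangent to Σ₁ (their β₁-, β₂-, and γ-components vanish there); and (ii) the function I_* = (α₁ + α₃)² + α₂² satisfies T₁(I_*) = T₂(I_*) = T₃(I_*) = 0 and V₃(I_*) = 0 at every point of ℝ¹⁰, and V₁(I_*) = V₂(I_*) = 0 at every point of Σ₁. Hence I_* is an invariant of the induced isometry group action on the subspace Σ₁ of Killing tensors with β₁ = β₂ = γ = 0. -/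

import Mathlib

/- STATEMENT 11: On the subspace Σ₁ = {β₁ = β₂ = γ = 0} of the parameter space ℝ¹⁰,
(i) the six vector fields V₁, V₂, V₃, T₁, T₂, T₃ are tangent to Σ₁, and
(ii) the function I_* = (α₁ + α₃)² + α₂² is annihilated by T₁, T₂, T₃, V₃ everywhere
and by V₁, V₂ at every point of Σ₁; hence I_* is an invariant of the induced isometry
group action on Σ₁. -/

noncomputable section

/- Coordinates on ℝ¹⁰ = Fin 10 → ℝ:
0:a₁, 1:a₂, 2:a₃, 3:a₄, 4:α₁, 5:α₂, 6:α₃, 7:β₁, 8:β₂, 9:γ. -/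

def V₁ : (Fin 10 → ℝ) → (Fin 10 → ℝ) :=
  fun x => ![0, -x 4, -x 5, 3 * x 6, 0, -2 * x 7, 2 * x 8, 0, -x 9, 0]

def V₂ : (Fin 10 → ℝ) → (Fin 10 → ℝ) :=
  fun x => ![3 * x 4, x 5, -x 6, 0, 2 * x 7, 2 * x 8, 0, x 9, 0, 0]

def V₃ : (Fin 10 → ℝ) → (Fin 10 → ℝ) :=
  fun x => ![3 * x 1, 2 * x 2 - x 0, x 3 - 2 * x 1, -3 * x 2,
             x 5, -2 * (x 4 + x 6), x 5, x 8, -x 7, 0]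

def T₁ : (Fin 10 → ℝ) → (Fin 10 → ℝ) :=
  fun _ => ![3, 0, 1, 0, 0, 0, 0, 0, 0, 0]

def T₂ : (Fin 10 → ℝ) → (Fin 10 → ℝ) :=
  fun _ => ![0, 1, 0, 3, 0, 0, 0, 0, 0, 0]

def T₃ : (Fin 10 → ℝ) → (Fin 10 → ℝ) :=
  fun _ => ![0, 0, 0, 0, 1, 0, -1, 0, 0, 0]

/-- The subspace Σ₁ = {β₁ = β₂ = γ = 0}. -/
def Sigma₁ : Set (Fin 10 → ℝ) := {x | x 7 = 0 ∧ x 8 = 0 ∧ x 9 = 0}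

/-- I_* = (α₁ + α₃)² + α₂² -/
def Istar : (Fin 10 → ℝ) → ℝ := fun x => (x 4 + x 6) ^ 2 + (x 5) ^ 2

theorem fderiv_Istar_apply (x v : Fin 10 → ℝ) :
    fderiv ℝ Istar x v = 2 * (x 4 + x 6) * (v 4 + v 6) + 2 * x 5 * v 5 := by
  have h (i : Fin 10) : HasFDerivAt (fun y : Fin 10 → ℝ => y i)
      (ContinuousLinearMap.proj (R := ℝ) (φ := fun _ : Fin 10 => ℝ) i) x :=
    hasFDerivAt_apply i x
  have hI : HasFDerivAt Istar _ x := (((h 4).add (h 6)).pow 2).add ((h 5).pow 2)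
  rw [hI.fderiv]
  simp
  ring

theorem invariant_on_Sigma₁ :
    -- (i) tangency of the six vector fields to Σ₁
    (∀ x ∈ Sigma₁, ∀ W ∈ ({V₁, V₂, V₃, T₁, T₂, T₃} :
        Set ((Fin 10 → ℝ) → (Fin 10 → ℝ))),
      W x 7 = 0 ∧ W x 8 = 0 ∧ W x 9 = 0) ∧
    -- (ii) invariance of I_*
    (∀ x : Fin 10 → ℝ,
      fderiv ℝ Istar x (T₁ x) = 0 ∧
      fderiv ℝ Istar x (T₂ x) = 0 ∧
      fderiv ℝ Istar x (T₃ x) = 0 ∧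
      fderiv ℝ Istar x (V₃ x) = 0) ∧
    (∀ x ∈ Sigma₁,
      fderiv ℝ Istar x (V₁ x) = 0 ∧
      fderiv ℝ Istar x (V₂ x) = 0) := by
  refine ⟨?_, fun x => ?_, ?_⟩
  · rintro x ⟨h7, h8, h9⟩ W (rfl | rfl | rfl | rfl | rfl | rfl) <;>
      simp [V₁, V₂, V₃, T₁, T₂, T₃, h7, h8, h9]
  · simp only [fderiv_Istar_apply]
    refine ⟨?_, ?_, ?_, ?_⟩ <;> simp [T₁, T₂, T₃, V₃]
    ring
  · rintro x ⟨h7, h8, h9⟩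
    simp [fderiv_Istar_apply, V₁, V₂, h7, h8]
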